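/- arXiv:2006.08598 — 8 statements merged into one kernel-verified Lean document; each statement's English description precedes it below -/
import Mathlib

section
/- Let n ≥ 2 and let (a_1,b_1),…,(a_{n+1},b_{n+1}) be observations in ℝ². Let τ_n denote Kendall's τ of the first n observations and τ_{n+1} denote Kendall's τ of all n+1 observations. Then τ_{n+1} − τ_n ≤ 2/(n−1). (This is the increment-sensitivity bound of Kendall's τ established in the paper's proof that Kendall's τ is 2/(n−1)-sensitive.) -/
open Finset

/-- Number of concordant pairs among the first `m` observations `(a i, b i)`. -/
noncomputable def concordantCount (a b : ℕ → ℝ) (m : ℕ) : ℕ :=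
  ((range m ×ˢ range m).filter
    (fun p => p.1 < p.2 ∧ 0 < (a p.1 - a p.2) * (b p.1 - b p.2))).card

/-- Number of discordant pairs among the first `m` observations `(a i, b i)`. -/
noncomputable def discordantCount (a b : ℕ → ℝ) (m : ℕ) : ℕ :=
  ((range m ×ˢ range m).filter
    (fun p => p.1 < p.2 ∧ (a p.1 - a p.2) * (b p.1 - b p.2) < 0)).card

/-- Kendall's τ of the first `m` observations: `τ = 2|C - D| / (m(m-1))`. -/
noncomputable def kendallTau (a b : ℕ → ℝ) (m : ℕ) : ℝ :=
  2 * |(concordantCount a b m : ℝ) - (discordantCount a b m : ℝ)| /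
    ((m : ℝ) * ((m : ℝ) - 1))

theorem aux_count (P : ℕ × ℕ → Prop) [DecidablePred P] (n : ℕ) :
    ((range (n+1) ×ˢ range (n+1)).filter (fun p => p.1 < p.2 ∧ P p)).card =
    ((range n ×ˢ range n).filter (fun p => p.1 < p.2 ∧ P p)).card +
      ((range n).filter (fun i => P (i, n))).card := by
  have h : (range (n+1) ×ˢ range (n+1)).filter (fun p => p.1 < p.2 ∧ P p) =
      (range n ×ˢ range n).filter (fun p => p.1 < p.2 ∧ P p) ∪
      ((range n).filter (fun i => P (i, n))).image (fun i => (i, n)) := by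
    ext ⟨i, j⟩
    simp only [mem_filter, mem_product, mem_range, mem_union, mem_image, Prod.mk.injEq]
    constructor
    · rintro ⟨⟨h1, h2⟩, h3, h4⟩
      rcases Nat.lt_succ_iff_lt_or_eq.mp h2 with h | h
      · left; exact ⟨⟨by omega, h⟩, h3, h4⟩
      · right; subst h; exact ⟨i, ⟨h3, h4⟩, rfl, rfl⟩
    · rintro (⟨⟨h1, h2⟩, h3, h4⟩ | ⟨k, ⟨h1, h2⟩, rfl, rfl⟩)
      · exact ⟨⟨by omega, by omega⟩, h3, h4⟩
      · exact ⟨⟨by omega, by omega⟩, h1, h2⟩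
  rw [h, card_union_of_disjoint, card_image_of_injective]
  · intro x y hxy; simpa using hxy
  · rw [Finset.disjoint_left]
    rintro ⟨i, j⟩ h1 h2
    simp only [mem_filter, mem_product, mem_range, mem_image, Prod.mk.injEq] at h1 h2
    obtain ⟨k, _, _, h3⟩ := h2
    omega

theorem stmt_2 (n : ℕ) (hn : 2 ≤ n) (a b : ℕ → ℝ) :
    kendallTau a b (n + 1) - kendallTau a b n ≤ 2 / ((n : ℝ) - 1) := by
  have hC := aux_count (fun p => 0 < (a p.1 - a p.2) * (b p.1 - b p.2)) n
  have hD := aux_count (fun p => (a p.1 - a p.2) * (b p.1 - b p.2) < 0) n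
  have hx := card_filter_le (range n) (fun i => 0 < (a i - a n) * (b i - b n))
  have hy := card_filter_le (range n) (fun i => (a i - a n) * (b i - b n) < 0)
  rw [card_range] at hx hy
  change concordantCount a b (n+1) = concordantCount a b n + _ at hC
  change discordantCount a b (n+1) = discordantCount a b n + _ at hD
  unfold kendallTau
  rw [hC, hD]
  generalize (concordantCount a b n) = C
  generalize (discordantCount a b n) = D
  simp only
  generalize (#{i ∈ range n | 0 < (a i - a n) * (b i - b n)}) = x at *
  generalize (#{i ∈ range n | (a i - a n) * (b i - b n) < 0}) = y at *
  have hx' : (x:ℝ) ≤ n := by exact_mod_cast hx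
  have hy' : (y:ℝ) ≤ n := by exact_mod_cast hy
  have hn' : (2:ℝ) ≤ n := by exact_mod_cast hn
  have hx0 : (0:ℝ) ≤ x := by positivity
  have hy0 : (0:ℝ) ≤ y := by positivity
  push_cast
  have hS : |((C:ℝ) + x) - (D + y)| ≤ |(C:ℝ) - D| + n := by
    have : ((C:ℝ) + x) - (D + y) = (C - D) + (x - y) := by ring
    rw [this]
    refine (abs_add_le _ _).trans ?_
    have : |(x:ℝ) - y| ≤ n := abs_le.mpr ⟨by linarith, by linarith⟩
    linarith
  generalize |((C:ℝ) + x) - (D + y)| = S' at *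
  have hS0 : 0 ≤ |(C:ℝ) - D| := abs_nonneg _
  generalize |(C:ℝ) - D| = S at *
  have h1 : 2 * S' / (((n:ℝ) + 1) * (n + 1 - 1)) ≤ 2 * (S + n) / (((n:ℝ) + 1) * n) := by
    rw [add_sub_cancel_right]; gcongr
  have h2 : 2 * (S + n) / (((n:ℝ) + 1) * n) = 2 * S / (((n:ℝ) + 1) * n) + 2 / (n + 1) := by
    field_simp
  have hp : (0:ℝ) < n - 1 := by linarith
  have h3 : 2 * S / (((n:ℝ) + 1) * n) ≤ 2 * S / ((n:ℝ) * (n - 1)) := by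
    apply div_le_div_of_nonneg_left (by positivity) (by positivity); nlinarith
  have h4 : 2 / ((n:ℝ) + 1) ≤ 2 / (n - 1) := by
    apply div_le_div_of_nonneg_left (by positivity) hp; linarith
  linarith
end

section
/- Let c₁ ≥ 2 be a real number, k ≥ 1, and let n_1,…,n_k be natural numbers with n_j ≥ c₁ for all j. Let n = Σ_{j=1}^k n_j, w_j = 9n_j(n_j−1)/(2(2n_j+5)), and c₂ = 9c₁/(2(2c₁+5)). Then for every i, w_i/√(Σ_{j=1}^k w_j) ≤ 9(n_i−1)/(4√(c₂(n−k))). -/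
open Finset

/-- The weight assigned to a block of size `m` in conditional Kendall's τ:
`w(m) = 9m(m-1)/(2(2m+5))`. -/
noncomputable def wKendall (m : ℝ) : ℝ := 9 * m * (m - 1) / (2 * (2 * m + 5))

theorem stmt_7 (c₁ : ℝ) (hc₁ : 2 ≤ c₁) (k : ℕ) (hk : 1 ≤ k)
    (nb : Fin k → ℕ) (hnb : ∀ j, c₁ ≤ (nb j : ℝ)) (i : Fin k) :
    wKendall (nb i) / Real.sqrt (∑ j, wKendall (nb j)) ≤
      9 * ((nb i : ℝ) - 1) /
        (4 * Real.sqrt ((9 * c₁ / (2 * (2 * c₁ + 5))) * ((∑ j, (nb j : ℝ)) - (k : ℝ)))) := by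
  have hc5 : (0:ℝ) < 2 * (2 * c₁ + 5) := by linarith
  have hc2 : 0 < 9 * c₁ / (2 * (2 * c₁ + 5)) := div_pos (by linarith) hc5
  have hw : ∀ j, (9 * c₁ / (2 * (2 * c₁ + 5))) * ((nb j : ℝ) - 1) ≤ wKendall (nb j) := by
    intro j
    have h := hnb j
    unfold wKendall
    have h5 : (0:ℝ) < 2 * (2 * (nb j : ℝ) + 5) := by linarith
    have e : 9 * (nb j : ℝ) * ((nb j : ℝ) - 1) / (2 * (2 * (nb j : ℝ) + 5))
        = (9 * (nb j : ℝ) / (2 * (2 * (nb j : ℝ) + 5))) * ((nb j : ℝ) - 1) := by ring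
    rw [e]
    apply mul_le_mul_of_nonneg_right _ (by linarith)
    rw [div_le_div_iff₀ hc5 h5]
    nlinarith
  have hsum : (9 * c₁ / (2 * (2 * c₁ + 5))) * ((∑ j, (nb j : ℝ)) - (k : ℝ))
      ≤ ∑ j, wKendall (nb j) := by
    have e : (∑ j, (nb j : ℝ)) - (k : ℝ) = ∑ j, ((nb j : ℝ) - 1) := by
      simp [Finset.sum_sub_distrib]
    rw [e, Finset.mul_sum]
    exact Finset.sum_le_sum fun j _ => hw j
  have hpos : 0 < (∑ j, (nb j : ℝ)) - (k : ℝ) := by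
    have e : (∑ j, (nb j : ℝ)) - (k : ℝ) = ∑ j, ((nb j : ℝ) - 1) := by
      simp [Finset.sum_sub_distrib]
    rw [e]
    exact Finset.sum_pos (fun j _ => by linarith [hnb j]) ⟨i, Finset.mem_univ i⟩
  have hi := hnb i
  have hwi : wKendall (nb i) ≤ 9 * ((nb i : ℝ) - 1) / 4 := by
    unfold wKendall
    rw [div_le_div_iff₀ (by linarith) (by norm_num)]
    nlinarith
  rw [← div_div]
  exact div_le_div₀ (by linarith) hwi (Real.sqrt_pos.2 (mul_pos hc2 hpos)) (Real.sqrt_le_sqrt hsum)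
end

section
/- Let c₁ ≥ 2 be a real number. Consider a dataset of observation pairs in ℝ² partitioned into k ≥ 1 blocks with sizes n_1,…,n_k, where n_j ≥ c₁ for all j, and let n = Σ_{j=1}^k n_j and c₂ = 9c₁/(2(2c₁+5)). Suppose one new observation is appended to block i, where n_i ≥ c₁ + 1, leaving all other blocks unchanged, and let τ and τ' denote the conditional Kendall's τ of the dataset before and after the insertion. Then τ' − τ ≤ 27/(4√(c₂(n−k))) + 9/(2c₁√(c₂(n−k))). (This is the increment-sensitivity bound for conditional Kendall's τ established by the paper.) -/
open Finset

/-- Conditional Kendall's τ of a dataset consisting of `k` blocks, where block `j`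
consists of the observations `(a j 0, b j 0), …, (a j (nb j - 1), b j (nb j - 1))`:
`τ = (Σ_j w_j τ_j) / √(Σ_j w_j)`. -/
noncomputable def condKendallTau (k : ℕ) (a b : Fin k → ℕ → ℝ) (nb : Fin k → ℕ) : ℝ :=
  (∑ j, wKendall (nb j) * kendallTau (a j) (b j) (nb j)) /
    Real.sqrt (∑ j, wKendall (nb j))


lemma count_step (P : ℕ → ℕ → Prop) (m : ℕ) [DecidablePred fun p : ℕ × ℕ => p.1 < p.2 ∧ P p.1 p.2] :
    ∃ e ≤ m, ((range (m+1) ×ˢ range (m+1)).filter (fun p => p.1 < p.2 ∧ P p.1 p.2)).card =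
      ((range m ×ˢ range m).filter (fun p => p.1 < p.2 ∧ P p.1 p.2)).card + e := by
  classical
  refine ⟨((range m ×ˢ {m}).filter (fun p => p.1 < p.2 ∧ P p.1 p.2)).card, ?_, ?_⟩
  · refine (card_filter_le _ _).trans ?_
    simp
  · rw [← card_union_of_disjoint]
    · congr 1
      ext ⟨x, y⟩
      simp only [mem_filter, mem_product, mem_range, mem_union, mem_singleton]
      constructor
      · rintro ⟨⟨h1, h2⟩, h3, h4⟩
        rcases Nat.lt_succ_iff_lt_or_eq.mp h2 with h | h
        · exact Or.inl ⟨⟨by omega, h⟩, h3, h4⟩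
        · exact Or.inr ⟨⟨by omega, h⟩, h3, h4⟩
      · rintro (⟨⟨h1, h2⟩, h3⟩ | ⟨⟨h1, h2⟩, h3⟩)
        · exact ⟨⟨by omega, by omega⟩, h3⟩
        · exact ⟨⟨by omega, by omega⟩, h3⟩
    · rw [disjoint_left]
      rintro ⟨x, y⟩ h h'
      simp only [mem_filter, mem_product, mem_range, mem_singleton] at h h'
      omega

lemma S_step (a b : ℕ → ℝ) (m : ℕ) :
    |(concordantCount a b (m+1) : ℝ) - (discordantCount a b (m+1) : ℝ)| ≤
    |(concordantCount a b m : ℝ) - (discordantCount a b m : ℝ)| + m := by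
  classical
  obtain ⟨e, he, h1⟩ := count_step (fun x y => 0 < (a x - a y) * (b x - b y)) m
  obtain ⟨f, hf, h2⟩ := count_step (fun x y => (a x - a y) * (b x - b y) < 0) m
  have h1' : concordantCount a b (m+1) = concordantCount a b m + e := by
    unfold concordantCount; convert h1
  have h2' : discordantCount a b (m+1) = discordantCount a b m + f := by
    unfold discordantCount; convert h2
  rw [h1', h2']
  push_cast
  have he' : (e : ℝ) ≤ m := by exact_mod_cast he
  have hf' : (f : ℝ) ≤ m := by exact_mod_cast hf
  have he0 : (0 : ℝ) ≤ e := by positivity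
  have hf0 : (0 : ℝ) ≤ f := by positivity
  have : |(e : ℝ) - f| ≤ m := abs_le.mpr ⟨by linarith, by linarith⟩
  have h := abs_add_le ((concordantCount a b m : ℝ) - (discordantCount a b m : ℝ)) ((e : ℝ) - f)
  rw [show (concordantCount a b m : ℝ) + e - (discordantCount a b m + f) =
    (concordantCount a b m : ℝ) - (discordantCount a b m : ℝ) + ((e : ℝ) - f) by ring]
  linarith

lemma wtau_eq (a b : ℕ → ℝ) (m : ℕ) (hm : 2 ≤ m) :
    wKendall m * kendallTau a b m =
      9 * |(concordantCount a b m : ℝ) - (discordantCount a b m : ℝ)| / (2 * m + 5) := by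
  have hm' : (2 : ℝ) ≤ m := by exact_mod_cast hm
  have h1 : (m : ℝ) - 1 ≠ 0 := by linarith
  have h2 : (m : ℝ) ≠ 0 := by linarith
  have h3 : 2 * (m : ℝ) + 5 ≠ 0 := by linarith
  unfold wKendall kendallTau
  field_simp

lemma wtau_step (a b : ℕ → ℝ) (m : ℕ) (hm : 2 ≤ m) :
    wKendall ((m + 1 : ℕ) : ℝ) * kendallTau a b (m + 1) ≤
      wKendall m * kendallTau a b m + 9 / 2 := by
  rw [wtau_eq a b m hm, wtau_eq a b (m+1) (by omega)]
  have h := S_step a b m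
  have hS := abs_nonneg ((concordantCount a b m : ℝ) - (discordantCount a b m : ℝ))
  set S' := |(concordantCount a b (m+1) : ℝ) - (discordantCount a b (m+1) : ℝ)|
  set S := |(concordantCount a b m : ℝ) - (discordantCount a b m : ℝ)|
  have hm' : (2 : ℝ) ≤ m := by exact_mod_cast hm
  push_cast
  have h5 : 9 * S' / (2 * ((m : ℝ) + 1) + 5) ≤ 9 * (S + m) / (2 * ((m : ℝ) + 1) + 5) := by
    gcongr
  have h6 : 9 * S / (2 * ((m : ℝ) + 1) + 5) ≤ 9 * S / (2 * m + 5) := by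
    gcongr; linarith
  have h7 : 9 * (m : ℝ) / (2 * ((m : ℝ) + 1) + 5) ≤ 9 / 2 := by
    rw [div_le_div_iff₀ (by positivity) (by norm_num)]; linarith
  rw [mul_add 9 S, add_div] at h5
  linarith

lemma wK_mono (m : ℕ) (hm : (1 : ℝ) ≤ m) : wKendall m ≤ wKendall ((m + 1 : ℕ) : ℝ) := by
  unfold wKendall
  push_cast
  rw [div_le_div_iff₀ (by positivity) (by positivity)]
  nlinarith [mul_nonneg (sub_nonneg.mpr hm) (sub_nonneg.mpr hm)]

lemma wK_lower (c m : ℝ) (hc : 2 ≤ c) (hm : c ≤ m) :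
    9 * c / (2 * (2 * c + 5)) * (m - 1) ≤ wKendall m := by
  have h : 9 * c / (2 * (2 * c + 5)) ≤ 9 * m / (2 * (2 * m + 5)) := by
    rw [div_le_div_iff₀ (by linarith) (by linarith)]
    nlinarith
  have := mul_le_mul_of_nonneg_right h (show (0:ℝ) ≤ m - 1 by linarith)
  unfold wKendall
  calc _ ≤ _ := this
    _ = _ := by ring

theorem stmt_8 (c₁ : ℝ) (hc₁ : 2 ≤ c₁) (k : ℕ) (hk : 1 ≤ k)
    (a b : Fin k → ℕ → ℝ) (nb : Fin k → ℕ)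
    (hnb : ∀ j, c₁ ≤ (nb j : ℝ)) (i : Fin k) (hni : c₁ + 1 ≤ (nb i : ℝ)) :
    condKendallTau k a b (fun j => if j = i then nb j + 1 else nb j) -
        condKendallTau k a b nb ≤
      27 / (4 * Real.sqrt ((9 * c₁ / (2 * (2 * c₁ + 5))) * ((∑ j, (nb j : ℝ)) - (k : ℝ)))) +
        9 / (2 * c₁ * Real.sqrt ((9 * c₁ / (2 * (2 * c₁ + 5))) * ((∑ j, (nb j : ℝ)) - (k : ℝ)))) := by
  have hkc : ∀ j : Fin k, c₁ ≤ (nb j : ℝ) := hnb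
  set c₂ : ℝ := 9 * c₁ / (2 * (2 * c₁ + 5)) with hc₂
  have hc₂pos : 0 < c₂ := by rw [hc₂]; positivity
  set W : ℝ := ∑ j, wKendall (nb j) with hW
  have hnk : (∑ j, (nb j : ℝ)) - (k : ℝ) = ∑ j, ((nb j : ℝ) - 1) := by
    rw [Finset.sum_sub_distrib]; simp
  have hpos : 0 < (∑ j, (nb j : ℝ)) - (k : ℝ) := by
    rw [hnk]
    refine Finset.sum_pos (fun j _ => ?_) ⟨i, Finset.mem_univ i⟩
    linarith [hnb j]
  have hXW : c₂ * ((∑ j, (nb j : ℝ)) - (k : ℝ)) ≤ W := by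
    rw [hnk, Finset.mul_sum]
    refine Finset.sum_le_sum (fun j _ => ?_)
    exact wK_lower c₁ _ hc₁ (hnb j)
  set X : ℝ := Real.sqrt (c₂ * ((∑ j, (nb j : ℝ)) - (k : ℝ))) with hX
  have hXpos : 0 < X := Real.sqrt_pos.mpr (mul_pos hc₂pos hpos)
  have hXle : X ≤ Real.sqrt W := Real.sqrt_le_sqrt hXW
  have hn1 : ∀ j, 2 ≤ nb j := fun j => by
    have := hnb j
    exact_mod_cast hc₁.trans this
  have key : condKendallTau k a b (fun j => if j = i then nb j + 1 else nb j) -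
        condKendallTau k a b nb ≤ (9 / 2) / Real.sqrt W := by
    unfold condKendallTau
    rw [← hW]
    have hterm : ∀ j, wKendall ((if j = i then nb j + 1 else nb j : ℕ) : ℝ) *
        kendallTau (a j) (b j) (if j = i then nb j + 1 else nb j) ≤
        wKendall (nb j) * kendallTau (a j) (b j) (nb j) + if j = i then 9 / 2 else 0 := by
      intro j
      split_ifs with h
      · exact wtau_step _ _ _ (hn1 j)
      · simp
    have hN := Finset.sum_le_sum (fun j (_ : j ∈ Finset.univ) => hterm j)
    rw [Finset.sum_add_distrib, Finset.sum_ite_eq' Finset.univ i] at hN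
    simp only [Finset.mem_univ, if_true] at hN
    have hWW : W ≤ ∑ j, wKendall ((if j = i then nb j + 1 else nb j : ℕ) : ℝ) := by
      refine Finset.sum_le_sum (fun j _ => ?_)
      split_ifs with h
      · exact wK_mono _ (by linarith [hnb j])
      · exact le_rfl
    have hN0 : 0 ≤ ∑ j, wKendall ((if j = i then nb j + 1 else nb j : ℕ) : ℝ) *
        kendallTau (a j) (b j) (if j = i then nb j + 1 else nb j) := by
      refine Finset.sum_nonneg (fun j _ => ?_)
      rw [wtau_eq _ _ _ (by split_ifs <;> linarith [hn1 j])]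
      positivity
    have h1 := div_le_div_of_nonneg_left hN0 (hXpos.trans_le hXle) (Real.sqrt_le_sqrt hWW)
    have h2 := div_le_div_of_nonneg_right hN (Real.sqrt_nonneg W)
    rw [add_div] at h2
    linarith
  have h3 : (9 / 2) / Real.sqrt W ≤ (27 / 4) / X := by
    apply div_le_div₀ <;> first | assumption | norm_num
  have h4 : 27 / (4 * X) = (27 / 4) / X := by rw [div_div]
  have h5 : 0 ≤ 9 / (2 * c₁ * X) := by positivity
  linarith
end

section
/- For every permutation σ of {1,…,n}, Σ_{i=1}^n (σ(i) − i)² ≤ (n³ − n)/3. -/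
theorem aux_sum (c : ℝ) (n : ℕ) :
    ∑ i ∈ Finset.range n, (2 * (i : ℝ) ^ 2 - 2 * c * i + c ^ 2 / 2)
      = (n : ℝ) * (n - 1) * (2 * n - 1) / 3 - c * (n * (n - 1)) + n * c ^ 2 / 2 := by
  induction n with
  | zero => simp
  | succ k ih =>
    rw [Finset.sum_range_succ, ih]
    push_cast
    ring

theorem stmt_10 (n : ℕ) (σ : Equiv.Perm (Fin n)) :
    ∑ i : Fin n, ((σ i : ℝ) - (i : ℝ)) ^ 2 ≤ ((n : ℝ) ^ 3 - (n : ℝ)) / 3 := by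
  let g : Fin n → ℝ := fun i => 2 * (i : ℝ) ^ 2 - 2 * ((n : ℝ) - 1) * i + ((n : ℝ) - 1) ^ 2 / 2
  have h1 : ∑ i, g i = ((n : ℝ) ^ 3 - n) / 6 := by
    have h := aux_sum ((n : ℝ) - 1) n
    rw [Finset.sum_range] at h
    refine h.trans ?_
    ring
  have h2 : ∑ i, g (σ i) = ∑ i, g i := Equiv.sum_comp σ g
  calc ∑ i : Fin n, ((σ i : ℝ) - (i : ℝ)) ^ 2 ≤ ∑ i, (g (σ i) + g i) := by
        apply Finset.sum_le_sum
        intro i _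
        simp only [g]
        nlinarith [sq_nonneg ((σ i : ℝ) + (i : ℝ) - ((n : ℝ) - 1))]
    _ = _ := by
        rw [Finset.sum_add_distrib, h2, h1]
        ring
end

section
/- Let n ≥ 2 and let (a_1,b_1),…,(a_n,b_n) be observations in ℝ² with a_1,…,a_n pairwise distinct and b_1,…,b_n pairwise distinct. Then Spearman's ρ of the observations satisfies 0 ≤ ρ ≤ 1. -/
open Finset

/-- The rank of the `i`-th value among the first `m` values of `a`:
the number of `j < m` with `a j ≤ a i`. -/
noncomputable def rankAmong (a : ℕ → ℝ) (m i : ℕ) : ℕ :=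
  ((range m).filter (fun j => a j ≤ a i)).card

/-- Spearman's ρ of the first `m` observations `(a i, b i)`:
`ρ = |1 - 6 Σ d_i² / (m(m²-1))|`, where `d_i` is the difference of the ranks of
`a i` and `b i`. -/
noncomputable def spearmanRho (a b : ℕ → ℝ) (m : ℕ) : ℝ :=
  |1 - 6 * (∑ i ∈ range m, ((rankAmong a m i : ℝ) - (rankAmong b m i : ℝ)) ^ 2) /
    ((m : ℝ) * ((m : ℝ) ^ 2 - 1))|

theorem rank_sum (n : ℕ) (a : ℕ → ℝ)
    (ha : ∀ i < n, ∀ j < n, a i = a j → i = j) (f : ℕ → ℝ) :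
    ∑ i ∈ range n, f (rankAmong a n i) = ∑ k ∈ Icc 1 n, f k := by
  have hlt : ∀ i < n, ∀ j < n, a i < a j → rankAmong a n i < rankAmong a n j := by
    intro i hi j hj hij
    unfold rankAmong
    apply Finset.card_lt_card
    rw [Finset.ssubset_iff_of_subset]
    · exact ⟨j, by simp [hj], by simp [hij]⟩
    · intro k hk
      simp only [Finset.mem_filter] at hk ⊢
      exact ⟨hk.1, hk.2.trans hij.le⟩
  have hinj : Set.InjOn (rankAmong a n) (range n : Set ℕ) := by
    intro i hi j hj hij
    simp only [Finset.coe_range, Set.mem_Iio] at hi hj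
    rcases lt_trichotomy (a i) (a j) with h | h | h
    · exact absurd hij (hlt i hi j hj h).ne
    · exact ha i hi j hj h
    · exact absurd hij (hlt j hj i hi h).ne'
  have himg : (range n).image (rankAmong a n) = Icc 1 n := by
    apply Finset.eq_of_subset_of_card_le
    · intro k hk
      obtain ⟨i, hi, rfl⟩ := Finset.mem_image.1 hk
      rw [Finset.mem_Icc]
      constructor
      · exact Finset.card_pos.2 ⟨i, by simpa using hi⟩
      · exact (Finset.card_filter_le _ _).trans (by simp)
    · rw [Finset.card_image_of_injOn hinj]; simp
  rw [← himg, Finset.sum_image hinj]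

theorem sum_Icc_quad (n : ℕ) (c : ℝ) :
    ∑ k ∈ Icc 1 n, (2 * (k : ℝ) ^ 2 - 2 * c * k) =
      (n : ℝ) * (n + 1) * (2 * n + 1) / 3 - c * n * (n + 1) := by
  induction n with
  | zero => simp
  | succ m ih =>
    rw [Finset.sum_Icc_succ_top (by omega), ih]
    push_cast
    ring

theorem stmt_11 (n : ℕ) (hn : 2 ≤ n) (a b : ℕ → ℝ)
    (ha : ∀ i < n, ∀ j < n, a i = a j → i = j)
    (hb : ∀ i < n, ∀ j < n, b i = b j → i = j) :
    0 ≤ spearmanRho a b n ∧ spearmanRho a b n ≤ 1 := by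
  refine ⟨abs_nonneg _, ?_⟩
  have hA := (rank_sum n a ha (fun k => 2 * (k : ℝ) ^ 2 - 2 * ((n : ℝ) + 1) * k)).trans
    (sum_Icc_quad n _)
  have hB := (rank_sum n b hb (fun k => 2 * (k : ℝ) ^ 2 - 2 * ((n : ℝ) + 1) * k)).trans
    (sum_Icc_quad n _)
  have hn' : (2 : ℝ) ≤ n := by exact_mod_cast hn
  have hpos : 0 < (n : ℝ) * ((n : ℝ) ^ 2 - 1) := by
    apply mul_pos <;> nlinarith
  have h0 : 0 ≤ ∑ i ∈ range n, ((rankAmong a n i : ℝ) - (rankAmong b n i : ℝ)) ^ 2 :=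
    Finset.sum_nonneg fun i _ => sq_nonneg _
  have h1 : 0 ≤ ∑ i ∈ range n, ((rankAmong a n i : ℝ) + rankAmong b n i - (n + 1)) ^ 2 :=
    Finset.sum_nonneg fun i _ => sq_nonneg _
  have hS : ∑ i ∈ range n, ((rankAmong a n i : ℝ) - (rankAmong b n i : ℝ)) ^ 2 +
      ∑ i ∈ range n, ((rankAmong a n i : ℝ) + rankAmong b n i - (n + 1)) ^ 2 =
      (n : ℝ) * ((n : ℝ) ^ 2 - 1) / 3 := by
    have hC : ∑ i ∈ range n, ((n : ℝ) + 1) ^ 2 = n * ((n : ℝ) + 1) ^ 2 := by simp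
    trans (∑ i ∈ range n, (2 * (rankAmong a n i : ℝ) ^ 2 - 2 * ((n : ℝ) + 1) * rankAmong a n i)
      + ∑ i ∈ range n, (2 * (rankAmong b n i : ℝ) ^ 2 - 2 * ((n : ℝ) + 1) * rankAmong b n i))
      + ∑ i ∈ range n, ((n : ℝ) + 1) ^ 2
    · simp only [← Finset.sum_add_distrib]
      exact Finset.sum_congr rfl fun i _ => by ring
    · rw [hA, hB, hC]; ring
  unfold spearmanRho
  rw [abs_le]
  constructor
  · have : 6 * (∑ i ∈ range n, ((rankAmong a n i : ℝ) - (rankAmong b n i : ℝ)) ^ 2) /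
        ((n : ℝ) * ((n : ℝ) ^ 2 - 1)) ≤ 2 := by
      rw [div_le_iff₀ hpos]; linarith
    linarith
  · have : 0 ≤ 6 * (∑ i ∈ range n, ((rankAmong a n i : ℝ) - (rankAmong b n i : ℝ)) ^ 2) /
        ((n : ℝ) * ((n : ℝ) ^ 2 - 1)) := by positivity
    linarith
end

section
/- Let n ≥ 2 and let (a_1,b_1),…,(a_{n+1},b_{n+1}) be observations in ℝ² with a_1,…,a_{n+1} pairwise distinct and b_1,…,b_{n+1} pairwise distinct. Let ρ_n denote Spearman's ρ of the first n observations and ρ_{n+1} denote Spearman's ρ of all n+1 observations. Then |ρ_{n+1} − ρ_n| ≤ 30/n. (Spearman's ρ is 30/n-sensitive under increment of the dataset.) -/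
open Finset

lemma rank_succ (a : ℕ → ℝ) (n i : ℕ) :
    (rankAmong a (n+1) i : ℝ) = rankAmong a n i + (if a n ≤ a i then 1 else 0) := by
  unfold rankAmong
  rw [Finset.range_add_one, Finset.filter_insert]
  split_ifs with h
  · rw [Finset.card_insert_of_notMem (by simp)]
    push_cast; ring
  · simp

lemma rank_bounds (a : ℕ → ℝ) (n i : ℕ) (hi : i < n) :
    (1 : ℝ) ≤ rankAmong a n i ∧ (rankAmong a n i : ℝ) ≤ n := by
  unfold rankAmong
  constructor
  · have : 0 < ((range n).filter (fun j => a j ≤ a i)).card :=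
      Finset.card_pos.mpr ⟨i, by simp [hi]⟩
    exact_mod_cast this
  · have := Finset.card_filter_le (range n) (fun j => a j ≤ a i)
    rw [Finset.card_range] at this
    exact_mod_cast this

lemma final_alg (x S S' : ℝ) (hN : 2 ≤ x) (hS0 : 0 ≤ S) (hS1 : S ≤ x * (x - 1)^2)
    (hlo : -(2 * x * (x - 1)) ≤ S' - S) (hhi : S' - S ≤ 3 * x^2 - x) :
    |(1 - 6 * S' / ((x + 1) * ((x + 1)^2 - 1))) - (1 - 6 * S / (x * (x^2 - 1)))| ≤ 30 / x := by
  have h1 : 0 < x - 1 := by linarith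
  have h0 : 0 < x := by linarith
  have h2 : 0 < x + 1 := by linarith
  have h3 : 0 < x + 2 := by linarith
  have e1 : (x + 1) * ((x + 1)^2 - 1) = (x + 1) * x * (x + 2) := by ring
  have e2 : x * (x^2 - 1) = x * ((x - 1) * (x + 1)) := by ring
  have e : (1 - 6 * S' / ((x + 1) * ((x + 1)^2 - 1))) - (1 - 6 * S / (x * (x^2 - 1)))
      = (18 * S - 6 * (S' - S) * (x - 1)) / ((x - 1) * (x + 1) * (x + 2)) / x := by
    rw [e1, e2]
    field_simp
    ring
  have hP : 0 < (x - 1) * (x + 1) * (x + 2) := by positivity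
  have k1 := mul_le_mul_of_nonneg_right hlo h1.le
  have k2 := mul_le_mul_of_nonneg_right hhi h1.le
  rw [e, abs_div, abs_of_pos h0]
  gcongr
  rw [abs_le, le_div_iff₀ hP, div_le_iff₀ hP]
  constructor
  · nlinarith [mul_pos h1 h0, mul_pos (mul_pos h1 h0) h0]
  · nlinarith [mul_pos h1 h0, mul_pos (mul_pos h1 h0) h0]

theorem stmt_12 (n : ℕ) (hn : 2 ≤ n) (a b : ℕ → ℝ)
    (ha : ∀ i < n + 1, ∀ j < n + 1, a i = a j → i = j)
    (hb : ∀ i < n + 1, ∀ j < n + 1, b i = b j → i = j) :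
    |spearmanRho a b (n + 1) - spearmanRho a b n| ≤ 30 / (n : ℝ) := by
  have hN : (2 : ℝ) ≤ n := by exact_mod_cast hn
  unfold spearmanRho
  refine (abs_abs_sub_abs_le_abs_sub _ _).trans ?_
  set S := ∑ i ∈ range n, ((rankAmong a n i : ℝ) - (rankAmong b n i : ℝ)) ^ 2 with hS
  set S' := ∑ i ∈ range (n+1), ((rankAmong a (n+1) i : ℝ) - (rankAmong b (n+1) i : ℝ)) ^ 2 with hS'
  have hS0 : 0 ≤ S := Finset.sum_nonneg fun i _ => sq_nonneg _
  have hd : ∀ i < n, |(rankAmong a n i : ℝ) - rankAmong b n i| ≤ n - 1 := by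
    intro i hi
    have h1 := rank_bounds a n i hi
    have h2 := rank_bounds b n i hi
    rw [abs_le]; constructor <;> linarith
  have hS1 : S ≤ n * ((n:ℝ) - 1)^2 := by
    have := Finset.sum_le_card_nsmul (range n)
      (fun i => ((rankAmong a n i : ℝ) - (rankAmong b n i : ℝ)) ^ 2) (((n:ℝ) - 1)^2)
      (fun i hi => sq_le_sq' (by have := abs_le.mp (hd i (by simpa using hi)); linarith)
        (by have := abs_le.mp (hd i (by simpa using hi)); linarith))
    simpa using this
  have hlast : ((rankAmong a (n+1) n : ℝ) - (rankAmong b (n+1) n : ℝ)) ^ 2 ≤ (n:ℝ)^2 := by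
    have h1 := rank_bounds a (n+1) n (by omega)
    have h2 := rank_bounds b (n+1) n (by omega)
    push_cast at h1 h2
    apply sq_le_sq' <;> linarith
  have hterm : ∀ i ∈ range n,
      |((rankAmong a (n+1) i : ℝ) - (rankAmong b (n+1) i : ℝ)) ^ 2
        - ((rankAmong a n i : ℝ) - (rankAmong b n i : ℝ)) ^ 2 - (1/2 : ℝ)| ≤ 2 * ((n:ℝ) - 1) + 1/2 := by
    intro i hi
    have h := abs_le.mp (hd i (by simpa using hi))
    rw [rank_succ, rank_succ, abs_le]
    split_ifs <;> constructor <;> nlinarith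
  have hsum : |∑ i ∈ range n, (((rankAmong a (n+1) i : ℝ) - (rankAmong b (n+1) i : ℝ)) ^ 2
        - ((rankAmong a n i : ℝ) - (rankAmong b n i : ℝ)) ^ 2 - (1/2 : ℝ))| ≤ (n:ℝ) * (2 * ((n:ℝ) - 1) + 1/2) := by
    refine (Finset.abs_sum_le_sum_abs _ _).trans ?_
    have := Finset.sum_le_card_nsmul _ _ _ hterm
    rwa [Finset.card_range, nsmul_eq_mul] at this
  have hS'2 := hS'
  rw [Finset.sum_range_succ] at hS'2
  rw [Finset.sum_sub_distrib, Finset.sum_sub_distrib, ← hS, abs_le] at hsum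
  simp only [Finset.sum_const, Finset.card_range, nsmul_eq_mul] at hsum
  have hl0 := sq_nonneg ((rankAmong a (n+1) n : ℝ) - (rankAmong b (n+1) n : ℝ))
  have hlo : -(2 * n * ((n:ℝ)-1)) ≤ S' - S := by linarith [hsum.1]
  have hhi : S' - S ≤ 3 * n^2 - n := by linarith [hsum.2]
  clear_value S S'
  push_cast
  exact final_alg n S S' hN hS0 hS1 hlo hhi
end

section
/- Let c₁ ≥ 2 be a real number. Consider a dataset of observation pairs in ℝ² partitioned into k ≥ 1 blocks with sizes n_1,…,n_k, where n_j ≥ 2 for all j and n_i ≥ c₁ for a fixed block i, the a-values and b-values being pairwise distinct within each block; let n = Σ_{j=1}^k n_j. Suppose one new observation is appended to block i (preserving the pairwise-distinctness of a-values and of b-values within block i), leaving all other blocks unchanged, and let ρ and ρ' denote the conditional Spearman's ρ of the dataset before and after the insertion. Then ρ' − ρ ≤ 31/√(n−k) + 30/(c₁√(n−k)). (This is the increment-sensitivity bound for conditional Spearman's ρ established by the paper.) -/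
open Finset

/-- Conditional Spearman's ρ of a dataset consisting of `k` blocks, where block `j`
consists of the observations `(a j 0, b j 0), …, (a j (nb j - 1), b j (nb j - 1))`,
with weights `w_j = n_j - 1`:
`ρ = (Σ_j (n_j - 1) ρ_j) / √(Σ_j (n_j - 1)) = (Σ_j (n_j - 1) ρ_j) / √(n - k)`. -/
noncomputable def condSpearmanRho (k : ℕ) (a b : Fin k → ℕ → ℝ) (nb : Fin k → ℕ) : ℝ :=
  (∑ j, ((nb j : ℝ) - 1) * spearmanRho (a j) (b j) (nb j)) /
    Real.sqrt ((∑ j, (nb j : ℝ)) - (k : ℝ))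

lemma rank_le_aux (a : ℕ → ℝ) (m i : ℕ) : rankAmong a m i ≤ m := by
  unfold rankAmong
  exact (card_filter_le _ _).trans (by simp)

lemma rank_succ_aux (a : ℕ → ℝ) (m i : ℕ) :
    rankAmong a (m + 1) i = rankAmong a m i ∨ rankAmong a (m + 1) i = rankAmong a m i + 1 := by
  unfold rankAmong
  rw [range_add_one, filter_insert]
  split_ifs with h
  · right
    rw [card_insert_of_notMem (by simp)]
  · left; rfl

lemma d_abs_aux (a b : ℕ → ℝ) (m i : ℕ) :
    |(rankAmong a m i : ℝ) - (rankAmong b m i : ℝ)| ≤ m := by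
  have h1 : (rankAmong a m i : ℝ) ≤ m := by exact_mod_cast rank_le_aux a m i
  have h2 : (rankAmong b m i : ℝ) ≤ m := by exact_mod_cast rank_le_aux b m i
  have h3 : (0 : ℝ) ≤ rankAmong a m i := by positivity
  have h4 : (0 : ℝ) ≤ rankAmong b m i := by positivity
  rw [abs_le]; constructor <;> linarith

lemma d_step_aux (a b : ℕ → ℝ) (m i : ℕ) :
    |((rankAmong a (m+1) i : ℝ) - (rankAmong b (m+1) i : ℝ)) ^ 2
      - ((rankAmong a m i : ℝ) - (rankAmong b m i : ℝ)) ^ 2| ≤ 2 * m + 1 := by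
  have h := d_abs_aux a b m i
  rw [abs_le] at h
  obtain ⟨h1, h2⟩ := h
  have h0 : (0 : ℝ) ≤ m := by positivity
  rcases rank_succ_aux a m i with e | e <;> rcases rank_succ_aux b m i with f | f <;>
    rw [e, f, abs_le] <;> push_cast <;> constructor <;> nlinarith

lemma D_step_aux (a b : ℕ → ℝ) (m : ℕ) :
    |(∑ i ∈ range (m+1), ((rankAmong a (m+1) i : ℝ) - (rankAmong b (m+1) i : ℝ)) ^ 2)
      - ∑ i ∈ range m, ((rankAmong a m i : ℝ) - (rankAmong b m i : ℝ)) ^ 2|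
      ≤ 3 * (m : ℝ) ^ 2 + 3 * m + 1 := by
  rw [sum_range_succ, add_sub_right_comm, ← sum_sub_distrib]
  have h1 := (abs_sum_le_sum_abs (fun i => ((rankAmong a (m+1) i : ℝ) - (rankAmong b (m+1) i : ℝ)) ^ 2
      - ((rankAmong a m i : ℝ) - (rankAmong b m i : ℝ)) ^ 2) (range m)).trans
    (sum_le_sum (fun i _ => d_step_aux a b m i))
  have h2 : |((rankAmong a (m+1) m : ℝ) - (rankAmong b (m+1) m : ℝ)) ^ 2| ≤ ((m : ℝ) + 1) ^ 2 := by
    rw [abs_pow]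
    have := d_abs_aux a b (m+1) m
    push_cast at this
    gcongr
  rw [sum_const, card_range, nsmul_eq_mul] at h1
  refine (abs_add_le _ _).trans ?_
  linarith

lemma D_le_aux (a b : ℕ → ℝ) (m : ℕ) :
    ∑ i ∈ range m, ((rankAmong a m i : ℝ) - (rankAmong b m i : ℝ)) ^ 2 ≤ (m : ℝ) ^ 3 := by
  have : ∀ i ∈ range m, ((rankAmong a m i : ℝ) - (rankAmong b m i : ℝ)) ^ 2 ≤ (m : ℝ) ^ 2 := by
    intro i _
    rw [← sq_abs]
    have := d_abs_aux a b m i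
    gcongr
  have h := sum_le_sum this
  rw [sum_const, card_range, nsmul_eq_mul] at h
  linarith

lemma core_aux (m A B : ℝ) (hm : 2 ≤ m) (hA : 0 ≤ A) (hA' : A ≤ m ^ 3)
    (h : |B - A| ≤ 3 * m ^ 2 + 3 * m + 1) :
    m * |1 - 6 * B / ((m + 1) * ((m + 1) ^ 2 - 1))| - (m - 1) * |1 - 6 * A / (m * (m ^ 2 - 1))|
      ≤ 31 := by
  have hm0 : (0 : ℝ) < m := by linarith
  have hm1 : (0 : ℝ) < m - 1 := by linarith
  have e1 : m * |1 - 6 * B / ((m + 1) * ((m + 1) ^ 2 - 1))| = |m - 6 * B / ((m + 1) * (m + 2))| := by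
    rw [← abs_of_pos hm0, ← abs_mul, abs_of_pos hm0]
    congr 1
    have : (m + 1) ^ 2 - 1 = m * (m + 2) := by ring
    rw [this]
    field_simp
  have e2 : (m - 1) * |1 - 6 * A / (m * (m ^ 2 - 1))| = |(m - 1) - 6 * A / (m * (m + 1))| := by
    rw [← abs_of_pos hm1, ← abs_mul, abs_of_pos hm1]
    congr 1
    have : m ^ 2 - 1 = (m - 1) * (m + 1) := by ring
    rw [this]
    field_simp
  rw [e1, e2]
  refine (abs_sub_abs_le_abs_sub _ _).trans ?_
  have e3 : m - 6 * B / ((m + 1) * (m + 2)) - ((m - 1) - 6 * A / (m * (m + 1)))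
      = 1 - 6 * (B - A) / ((m + 1) * (m + 2)) + 12 * (A / m) / ((m + 1) * (m + 2)) := by
    field_simp
    ring
  rw [e3]
  rw [abs_le] at h
  have hAm : A / m ≤ m ^ 2 := by
    rw [div_le_iff₀ hm0]; linarith
  have hAm0 : 0 ≤ A / m := by positivity
  have hp : 0 < (m + 1) * (m + 2) := by positivity
  have f1 : 6 * (B - A) / ((m + 1) * (m + 2)) ≤ 18 := by
    rw [div_le_iff₀ hp]; nlinarith
  have f2 : -18 ≤ 6 * (B - A) / ((m + 1) * (m + 2)) := by
    rw [le_div_iff₀ hp]; nlinarith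
  have f3 : 12 * (A / m) / ((m + 1) * (m + 2)) ≤ 12 := by
    rw [div_le_iff₀ hp]; nlinarith
  have f4 : 0 ≤ 12 * (A / m) / ((m + 1) * (m + 2)) := by positivity
  rw [abs_le]; constructor <;> linarith

lemma block_aux (a b : ℕ → ℝ) (m : ℕ) (hm : 2 ≤ m) :
    (((m + 1 : ℕ) : ℝ) - 1) * spearmanRho a b (m + 1) ≤ ((m : ℝ) - 1) * spearmanRho a b m + 31 := by
  have h := core_aux m _ _ (by exact_mod_cast hm)
    (sum_nonneg (fun i _ => sq_nonneg _)) (D_le_aux a b m) (D_step_aux a b m)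
  unfold spearmanRho
  push_cast
  push_cast at h
  rw [add_sub_cancel_right]
  linarith

theorem stmt_13 (c₁ : ℝ) (hc₁ : 2 ≤ c₁) (k : ℕ) (hk : 1 ≤ k)
    (a b : Fin k → ℕ → ℝ) (nb : Fin k → ℕ)
    (hnb : ∀ j, 2 ≤ nb j) (i : Fin k) (hni : c₁ ≤ (nb i : ℝ))
    (ha : ∀ j : Fin k, ∀ p < nb j, ∀ q < nb j, a j p = a j q → p = q)
    (hb : ∀ j : Fin k, ∀ p < nb j, ∀ q < nb j, b j p = b j q → p = q)
    (ha' : ∀ p < nb i + 1, ∀ q < nb i + 1, a i p = a i q → p = q)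
    (hb' : ∀ p < nb i + 1, ∀ q < nb i + 1, b i p = b i q → p = q) :
    condSpearmanRho k a b (fun j => if j = i then nb j + 1 else nb j) -
        condSpearmanRho k a b nb ≤
      31 / Real.sqrt ((∑ j, (nb j : ℝ)) - (k : ℝ)) +
        30 / (c₁ * Real.sqrt ((∑ j, (nb j : ℝ)) - (k : ℝ))) := by
  set N : ℝ := (∑ j, (nb j : ℝ)) - (k : ℝ) with hN
  set S : ℝ := ∑ j, ((nb j : ℝ) - 1) * spearmanRho (a j) (b j) (nb j) with hS
  have hS0 : 0 ≤ S := by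
    refine sum_nonneg (fun j _ => mul_nonneg ?_ (abs_nonneg _))
    have : (2 : ℝ) ≤ nb j := by exact_mod_cast hnb j
    linarith
  have hN0 : 0 < N := by
    have h1 : ∑ j : Fin k, (2 : ℝ) ≤ ∑ j, (nb j : ℝ) :=
      sum_le_sum (fun j _ => by exact_mod_cast hnb j)
    simp at h1
    have : (1 : ℝ) ≤ k := by exact_mod_cast hk
    linarith
  have hS' : ∑ j, (((if j = i then nb j + 1 else nb j : ℕ) : ℝ) - 1) *
      spearmanRho (a j) (b j) (if j = i then nb j + 1 else nb j) ≤ S + 31 := by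
    have h1 : S + 31 = ∑ j, (((nb j : ℝ) - 1) * spearmanRho (a j) (b j) (nb j)
        + if j = i then (31 : ℝ) else 0) := by
      rw [sum_add_distrib]; simp [hS]
    rw [h1]
    refine sum_le_sum (fun j _ => ?_)
    by_cases hj : j = i
    · simp only [hj, if_true]
      exact block_aux _ _ _ (hnb i)
    · simp [hj]
  have hN' : (∑ j, ((if j = i then nb j + 1 else nb j : ℕ) : ℝ)) - (k : ℝ) = N + 1 := by
    have h1 : ∑ j, ((if j = i then nb j + 1 else nb j : ℕ) : ℝ)
        = ∑ j, ((nb j : ℝ) + if j = i then (1 : ℝ) else 0) := by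
      refine sum_congr rfl (fun j _ => ?_)
      split_ifs <;> simp
    rw [h1, sum_add_distrib, hN]; simp; ring
  have hs : 0 < Real.sqrt N := Real.sqrt_pos.mpr hN0
  have hss : Real.sqrt N ≤ Real.sqrt (N + 1) := Real.sqrt_le_sqrt (by linarith)
  have hl : condSpearmanRho k a b (fun j => if j = i then nb j + 1 else nb j)
      ≤ (S + 31) / Real.sqrt N := by
    unfold condSpearmanRho
    rw [hN']
    have : 0 ≤ S + 31 := by linarith
    gcongr
  have hr : condSpearmanRho k a b nb = S / Real.sqrt N := rfl
  have h30 : 0 ≤ 30 / (c₁ * Real.sqrt N) := by positivity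
  rw [hr]
  rw [add_div] at hl
  linarith
end

section
/- Let Δ > 0 and ε' > 0, and let μ = Lap(2Δ/ε') ⊗ Lap(4Δ/ε') be the product of the two Laplace measures on ℝ². For all reals T, t, α, v with α + t ≥ 0 and v ≥ T + α, μ({(x,y) : v + y < T − t + x}) ≤ exp(−ε'(α+t)/(6Δ)) − (1/4)·exp(−ε'(α+t)/(3Δ)). (Type I error bound: the probability that the sieve step of one-off sieve-and-examine, which adds Lap(4Δ/ε') noise to a query value v and compares it to the noisy tweaked threshold T − t + Lap(2Δ/ε'), filters out a query with value at least T + α.) -/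
open MeasureTheory

/-- The Laplace measure `Lap(b)` on ℝ: the measure with density
`x ↦ (1/(2b)) · exp(−|x|/b)` with respect to Lebesgue measure. -/
noncomputable def laplaceMeasure (b : ℝ) : Measure ℝ :=
  volume.withDensity (fun x => ENNReal.ofReal ((1 / (2 * b)) * Real.exp (-|x| / b)))

theorem lap_Ioi (b a : ℝ) (hb : 0 < b) (ha : 0 ≤ a) :
    laplaceMeasure b (Set.Ioi a) = ENNReal.ofReal ((1 / 2) * Real.exp (-a / b)) := by
  rw [laplaceMeasure, withDensity_apply _ measurableSet_Ioi]
  have hn : -b⁻¹ < 0 := by simpa using hb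
  have h1 : ∀ x ∈ Set.Ioi a, ENNReal.ofReal ((1 / (2 * b)) * Real.exp (-|x| / b))
      = ENNReal.ofReal ((1 / (2 * b)) * Real.exp (-b⁻¹ * x)) := by
    intro x hx
    rw [abs_of_nonneg (ha.trans (le_of_lt hx))]
    congr 3
    field_simp
  rw [setLIntegral_congr_fun measurableSet_Ioi h1,
    ← ofReal_integral_eq_lintegral_ofReal ((integrableOn_exp_mul_Ioi hn a).const_mul _)
      (Filter.Eventually.of_forall fun x => by positivity),
    integral_const_mul, integral_exp_mul_Ioi hn]
  congr 1
  rw [show -b⁻¹ * a = -a / b by field_simp]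
  field_simp

theorem lap_Iic (b a : ℝ) (hb : 0 < b) (ha : 0 ≤ a) :
    laplaceMeasure b (Set.Iic (-a)) = ENNReal.ofReal ((1 / 2) * Real.exp (-a / b)) := by
  rw [laplaceMeasure, withDensity_apply _ measurableSet_Iic]
  have hn : 0 < b⁻¹ := by simpa using hb
  have h1 : ∀ x ∈ Set.Iic (-a), ENNReal.ofReal ((1 / (2 * b)) * Real.exp (-|x| / b))
      = ENNReal.ofReal ((1 / (2 * b)) * Real.exp (b⁻¹ * x)) := by
    intro x hx
    have : x ≤ -a := hx
    rw [abs_of_nonpos (by linarith)]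
    congr 3
    field_simp
  rw [setLIntegral_congr_fun measurableSet_Iic h1,
    ← ofReal_integral_eq_lintegral_ofReal ((integrableOn_exp_mul_Iic hn (-a)).const_mul _)
      (Filter.Eventually.of_forall fun x => by positivity),
    integral_const_mul, integral_exp_mul_Iic hn]
  congr 1
  rw [show b⁻¹ * (-a) = -a / b by field_simp]
  field_simp

theorem lap_prob (b : ℝ) (hb : 0 < b) : IsProbabilityMeasure (laplaceMeasure b) := by
  constructor
  have h1 := lap_Ioi b 0 hb le_rfl
  have h2 := lap_Iic b 0 hb le_rfl
  rw [neg_zero] at h2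
  rw [← Set.Iic_union_Ioi (a := (0 : ℝ)),
    measure_union (Set.Iic_disjoint_Ioi le_rfl) measurableSet_Ioi, h1, h2,
    ← ENNReal.ofReal_add (by positivity) (by positivity)]
  norm_num

theorem stmt_16 (Δ ε' : ℝ) (hΔ : 0 < Δ) (hε' : 0 < ε')
    (T t α v : ℝ) (hαt : 0 ≤ α + t) (hv : T + α ≤ v) :
    (laplaceMeasure (2 * Δ / ε')).prod (laplaceMeasure (4 * Δ / ε'))
        {p : ℝ × ℝ | v + p.2 < T - t + p.1} ≤
      ENNReal.ofReal (Real.exp (-(ε' * (α + t)) / (6 * Δ)) -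
        (1 / 4) * Real.exp (-(ε' * (α + t)) / (3 * Δ))) := by
  set b := 2 * Δ / ε' with hbdef
  have hb : 0 < b := by positivity
  have hb2 : 4 * Δ / ε' = 2 * b := by rw [hbdef]; ring
  rw [hb2]
  set s := α + t with hs
  have := lap_prob b hb
  have := lap_prob (2 * b) (by positivity)
  have e1 : -(ε' * s) / (6 * Δ) = -(s / 3) / b := by rw [hbdef]; field_simp; ring
  have e2 : -(ε' * s) / (3 * Δ) = -(s / 3) / b + -(s / 3) / b := by
    rw [hbdef]; field_simp; ring
  have e3 : -(2 * s / 3) / (2 * b) = -(s / 3) / b := by field_simp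
  have hA := lap_Ioi b (s / 3) hb (by positivity)
  have hB := lap_Iic (2 * b) (2 * s / 3) (by positivity) (by positivity)
  rw [e3] at hB
  rw [e1, e2, Real.exp_add]
  set q := Real.exp (-(s / 3) / b) with hq
  have hq0 : 0 < q := Real.exp_pos _
  have hq1 : q ≤ 1 := by
    rw [hq, Real.exp_le_one_iff]
    exact div_nonpos_of_nonpos_of_nonneg (by linarith) hb.le
  have hAc : laplaceMeasure b (Set.Ioi (s / 3))ᶜ = ENNReal.ofReal (1 - 1 / 2 * q) := by
    rw [prob_compl_eq_one_sub measurableSet_Ioi, hA, ENNReal.ofReal_sub _ (by positivity),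
      ENNReal.ofReal_one]
  have hsub : {p : ℝ × ℝ | v + p.2 < T - t + p.1} ⊆
      (Set.Ioi (s / 3) ×ˢ Set.univ) ∪ ((Set.Ioi (s / 3))ᶜ ×ˢ Set.Iic (-(2 * s / 3))) := by
    rintro ⟨x, y⟩ h
    simp only [Set.mem_setOf_eq] at h
    by_cases hx : s / 3 < x
    · left; simpa using hx
    · right
      simp only [Set.mem_prod, Set.mem_compl_iff, Set.mem_Ioi, Set.mem_Iic]
      exact ⟨hx, by linarith⟩
  refine (measure_mono hsub).trans ((measure_union_le _ _).trans ?_)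
  rw [Measure.prod_prod, Measure.prod_prod, measure_univ, mul_one, hA, hAc, hB,
    ← ENNReal.ofReal_mul (by linarith), ← ENNReal.ofReal_add (by positivity)
      (mul_nonneg (by linarith) (by positivity))]
  apply ENNReal.ofReal_le_ofReal
  apply le_of_eq
  ring
end
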